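/- arXiv:1401.4370 — 2 statements merged into one kernel-verified Lean document; each statement's English description precedes it below -/
import Mathlib

section
/- Let f : [a,b] → ℝ be absolutely continuous, let w : [a,b] → [0,∞) be integrable, and let x ∈ (a,b) be such that m(a,x) > 0 and m(x,b) > 0. Then |f(x) − (1/2)·[M(f,w;a,x) + M(f,w;x,b)]| ≤ ‖f'‖_1/2. -/
open MeasureTheory intervalIntegral

/-- If `f` stays within `C` of `y` on `[c, d]`, then so does its weighted mean. -/
theorem abs_sub_weighted_mean_le {c d y C : ℝ} {f w : ℝ → ℝ} (hcd : c ≤ d)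
    (hw : IntervalIntegrable w volume c d) (hw_nonneg : ∀ t ∈ Set.Icc c d, 0 ≤ w t)
    (hf : ContinuousOn f (Set.Icc c d)) (hC : ∀ t ∈ Set.Icc c d, |y - f t| ≤ C)
    (hm : 0 < ∫ t in c..d, w t) :
    |y - (∫ t in c..d, f t * w t) / (∫ t in c..d, w t)| ≤ C := by
  have hfw : IntervalIntegrable (fun t => f t * w t) volume c d :=
    hw.continuousOn_mul (by rwa [Set.uIcc_of_le hcd])
  have hdev : y * (∫ t in c..d, w t) - (∫ t in c..d, f t * w t) =
      ∫ t in c..d, (y - f t) * w t := by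
    rw [← intervalIntegral.integral_const_mul,
      ← intervalIntegral.integral_sub (hw.const_mul y) hfw]
    simp only [sub_mul]
  have hle : |∫ t in c..d, (y - f t) * w t| ≤ ∫ t in c..d, C * w t := by
    rw [← Real.norm_eq_abs]
    refine intervalIntegral.norm_integral_le_of_norm_le hcd
      (Filter.Eventually.of_forall fun t ht => ?_) (hw.const_mul C)
    have ht' := Set.Ioc_subset_Icc_self ht
    rw [Real.norm_eq_abs, abs_mul, abs_of_nonneg (hw_nonneg t ht')]
    exact mul_le_mul_of_nonneg_right (hC t ht') (hw_nonneg t ht')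
  rw [intervalIntegral.integral_const_mul] at hle
  rw [sub_div' hm.ne', hdev, abs_div, abs_of_pos hm]
  exact (div_le_iff₀ hm).2 hle

/-- The integral of `f'` over a subinterval is bounded by the integral of `|f'|` over a larger
interval. -/
theorem abs_integral_le_integral_abs_of_subset {c d s t : ℝ} {f' : ℝ → ℝ} (hcs : c ≤ s)
    (hst : s ≤ t) (htd : t ≤ d) (hint : IntervalIntegrable f' volume c d) :
    |∫ u in s..t, f' u| ≤ ∫ u in c..d, |f' u| :=
  (intervalIntegral.abs_integral_le_integral_abs hst).trans <|
    intervalIntegral.integral_mono_interval hcs hst htd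
      (Filter.Eventually.of_forall fun _ => abs_nonneg _) hint.abs

/-- **Corollary 1, `L_1` case** (`α = β`). If `f` is absolutely continuous on `[a,b]`
(expressed via the fundamental theorem of calculus with integrable density `f'`), `w ≥ 0`
is an integrable weight, and `x ∈ (a,b)` satisfies `m(a,x) > 0` and `m(x,b) > 0`, then
`|f(x) − (1/2)·(M(f,w;a,x) + M(f,w;x,b))| ≤ ‖f'‖_1/2`. -/
theorem weighted_ostrowski_symmetric_L1 (a b : ℝ) (hab : a < b) (f f' w : ℝ → ℝ)
    (hw_int : IntervalIntegrable w volume a b)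
    (hw_nonneg : ∀ t ∈ Set.Icc a b, 0 ≤ w t)
    (hf'int : IntervalIntegrable f' volume a b)
    (hftc : ∀ y ∈ Set.Icc a b, f y = f a + ∫ t in a..y, f' t)
    (x : ℝ) (hx : x ∈ Set.Ioo a b)
    (hmax : 0 < ∫ t in a..x, w t) (hmxb : 0 < ∫ t in x..b, w t) :
    |f x - (1 / 2) *
        ((∫ t in a..x, f t * w t) / (∫ t in a..x, w t) +
          (∫ t in x..b, f t * w t) / (∫ t in x..b, w t))| ≤
      (∫ t in a..b, |f' t|) / 2 := by
  obtain ⟨hax, hxb⟩ := hx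
  have hf'sub : ∀ {s t}, a ≤ s → s ≤ t → t ≤ b → IntervalIntegrable f' volume s t := by
    intro s t has hst htb
    refine hf'int.mono_set ?_
    rw [Set.uIcc_of_le hst, Set.uIcc_of_le hab.le]
    exact Set.Icc_subset_Icc has htb
  have hincr : ∀ {s t}, a ≤ s → s ≤ t → t ≤ b → f t - f s = ∫ u in s..t, f' u := by
    intro s t has hst htb
    rw [hftc t ⟨has.trans hst, htb⟩, hftc s ⟨has, hst.trans htb⟩,
      ← intervalIntegral.integral_add_adjacent_intervals
        (hf'sub le_rfl has (hst.trans htb)) (hf'sub has hst htb)]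
    ring
  have hf : ContinuousOn f (Set.Icc a b) := by
    have h := intervalIntegral.continuousOn_primitive_interval' hf'int Set.left_mem_uIcc
    rw [Set.uIcc_of_le hab.le] at h
    exact (continuousOn_const.add h).congr hftc
  have hwa : IntervalIntegrable w volume a x :=
    hw_int.mono_set (by
      rw [Set.uIcc_of_le hax.le, Set.uIcc_of_le hab.le]
      exact Set.Icc_subset_Icc_right hxb.le)
  have hwb : IntervalIntegrable w volume x b :=
    hw_int.mono_set (by
      rw [Set.uIcc_of_le hxb.le, Set.uIcc_of_le hab.le]
      exact Set.Icc_subset_Icc_left hax.le)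
  have hleft := abs_sub_weighted_mean_le (y := f x) (C := ∫ t in a..x, |f' t|) hax.le hwa
    (fun t ht => hw_nonneg t ⟨ht.1, ht.2.trans hxb.le⟩)
    (hf.mono (Set.Icc_subset_Icc_right hxb.le))
    (fun t ht => by
      rw [hincr ht.1 ht.2 hxb.le]
      exact abs_integral_le_integral_abs_of_subset ht.1 ht.2 le_rfl
        (hf'sub le_rfl hax.le hxb.le))
    hmax
  have hright := abs_sub_weighted_mean_le (y := f x) (C := ∫ t in x..b, |f' t|) hxb.le hwb
    (fun t ht => hw_nonneg t ⟨hax.le.trans ht.1, ht.2⟩)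
    (hf.mono (Set.Icc_subset_Icc_left hax.le))
    (fun t ht => by
      rw [abs_sub_comm, hincr hax.le ht.1 ht.2]
      exact abs_integral_le_integral_abs_of_subset le_rfl ht.1 ht.2
        (hf'sub hax.le hxb.le le_rfl))
    hmxb
  rw [← intervalIntegral.integral_add_adjacent_intervals
    (hf'sub le_rfl hax.le hxb.le).abs (hf'sub hax.le hxb.le le_rfl).abs]
  rw [abs_le] at hleft hright ⊢
  constructor <;> linarith [hleft.1, hleft.2, hright.1, hright.2]
end

section
/- Let f : [a,b] → ℝ be absolutely continuous with f' essentially bounded, let w : [a,b] → [0,∞) be integrable, let α, β ≥ 0 with α + β > 0, and suppose m(a,(a+b)/2) > 0, m((a+b)/2,b) > 0, and w(u) ≤ w((a+b)/2) for almost every u ∈ [a,b]. Then |f((a+b)/2) − (1/(α+β))·[α·M(f,w;a,(a+b)/2) + β·M(f,w;(a+b)/2,b)]| ≤ (1/(2(α+β)))·[α/m(a,(a+b)/2) + β/m((a+b)/2,b)]·((b−a)/2)²·w((a+b)/2)·‖f'‖_∞. -/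
open MeasureTheory intervalIntegral

/-- A function with an integrable density bounded a.e. by `M` is `M`-Lipschitz. -/
lemma abs_sub_le_mul_abs_sub_of_ae_density_le {a b : ℝ} {f f' : ℝ → ℝ} {M : ℝ}
    (hf'int : IntervalIntegrable f' volume a b)
    (hftc : ∀ y ∈ Set.Icc a b, f y = f a + ∫ t in a..y, f' t)
    (hM : ∀ᵐ t ∂(volume.restrict (Set.Icc a b)), |f' t| ≤ M)
    {x y : ℝ} (hx : x ∈ Set.Icc a b) (hy : y ∈ Set.Icc a b) :
    |f x - f y| ≤ M * |x - y| := by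
  have hint : ∀ z ∈ Set.Icc a b, IntervalIntegrable f' volume a z := fun z hz ↦
    hf'int.mono_set (Set.uIcc_subset_uIcc_left (Set.Icc_subset_uIcc hz))
  have hsub : f x - f y = ∫ t in y..x, f' t := by
    rw [← integral_interval_sub_left (hint x hx) (hint y hy), hftc x hx, hftc y hy]
    ring
  rw [hsub]
  refine norm_integral_le_of_norm_le_const_ae (f := f') ?_
  rw [ae_restrict_iff' measurableSet_Icc] at hM
  filter_upwards [hM] with t ht hmem
  exact ht (Set.uIcc_subset_Icc hy hx (Set.uIoc_subset_uIcc hmem))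

/-- Weighted Ostrowski inequality for a Lipschitz function and an a.e. bounded weight. -/
lemma abs_sub_weighted_mean_le_s12 {p q x W M : ℝ} {f w : ℝ → ℝ} (hpq : p ≤ q)
    (hf : ContinuousOn f (Set.Icc p q))
    (hlip : ∀ t ∈ Set.Icc p q, |f x - f t| ≤ M * |x - t|)
    (hw_int : IntervalIntegrable w volume p q)
    (hw_nonneg : ∀ t ∈ Set.Icc p q, 0 ≤ w t)
    (hw_le : ∀ᵐ t ∂(volume.restrict (Set.Icc p q)), w t ≤ W)
    (hm : 0 < ∫ t in p..q, w t) :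
    |f x - (∫ t in p..q, f t * w t) / (∫ t in p..q, w t)| ≤
      (M * W * ∫ t in p..q, |x - t|) / (∫ t in p..q, w t) := by
  have hfw : IntervalIntegrable (fun t ↦ f t * w t) volume p q :=
    hw_int.continuousOn_mul (by rwa [Set.uIcc_of_le hpq])
  have hdiff : ∫ t in p..q, (f x - f t) * w t =
      f x * (∫ t in p..q, w t) - ∫ t in p..q, f t * w t := by
    simp_rw [sub_mul]
    rw [intervalIntegral.integral_sub (hw_int.const_mul _) hfw, intervalIntegral.integral_const_mul]
  have hbound : |∫ t in p..q, (f x - f t) * w t| ≤ M * W * ∫ t in p..q, |x - t| := by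
    rw [← intervalIntegral.integral_const_mul, ← Real.norm_eq_abs]
    have hdom : IntervalIntegrable (fun t ↦ M * W * |x - t|) volume p q :=
      Continuous.intervalIntegrable (by fun_prop) p q
    refine intervalIntegral.norm_integral_le_of_norm_le hpq ?_ hdom
    rw [ae_restrict_iff' measurableSet_Icc] at hw_le
    filter_upwards [hw_le] with t ht hmem
    have htI := Set.Ioc_subset_Icc_self hmem
    have hl := hlip t htI
    rw [Real.norm_eq_abs, abs_mul, abs_of_nonneg (hw_nonneg t htI)]
    calc |f x - f t| * w t ≤ (M * |x - t|) * W :=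
          mul_le_mul hl (ht htI) (hw_nonneg t htI) ((abs_nonneg _).trans hl)
      _ = M * W * |x - t| := by ring
  rw [hdiff] at hbound
  rw [le_div_iff₀ hm]
  calc _ = |(f x - (∫ t in p..q, f t * w t) / (∫ t in p..q, w t)) * (∫ t in p..q, w t)| := by
        rw [abs_mul, abs_of_pos hm]
    _ = |f x * (∫ t in p..q, w t) - ∫ t in p..q, f t * w t| := by
        rw [sub_mul, div_mul_cancel₀ _ hm.ne']
    _ ≤ _ := hbound

lemma integral_abs_right_endpoint_sub {p x : ℝ} (h : p ≤ x) :
    ∫ t in p..x, |x - t| = (x - p) ^ 2 / 2 := by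
  rw [integral_congr (g := fun t ↦ x - t)]
  · rw [intervalIntegral.integral_sub (by simp) (by simp), intervalIntegral.integral_const, integral_id]
    simp only [smul_eq_mul]
    ring
  · intro t ht
    rw [Set.uIcc_of_le h] at ht
    exact abs_of_nonneg (sub_nonneg.2 ht.2)

lemma integral_abs_left_endpoint_sub {x q : ℝ} (h : x ≤ q) :
    ∫ t in x..q, |x - t| = (q - x) ^ 2 / 2 := by
  rw [integral_congr (g := fun t ↦ t - x)]
  · rw [intervalIntegral.integral_sub (by simp) (by simp), intervalIntegral.integral_const, integral_id]
    simp only [smul_eq_mul]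
    ring
  · intro t ht
    rw [Set.uIcc_of_le h] at ht
    simpa [abs_sub_comm] using abs_of_nonneg (sub_nonneg.2 ht.1)

/-- **Corollary 2, `L_∞` case** (midpoint). If `f` is absolutely continuous on `[a,b]`
(expressed via the fundamental theorem of calculus with integrable density `f'`), `f'` is
essentially bounded by `M` on `[a,b]`, `w ≥ 0` is an integrable weight, `α, β ≥ 0` with
`α + β > 0`, and `m(a,(a+b)/2) > 0`, `m((a+b)/2,b) > 0`, `w(u) ≤ w((a+b)/2)` for a.e.
`u ∈ [a,b]`, then
`|f((a+b)/2) − (1/(α+β))·(α·M(f,w;a,(a+b)/2) + β·M(f,w;(a+b)/2,b))|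
  ≤ (1/(2(α+β)))·(α/m(a,(a+b)/2) + β/m((a+b)/2,b))·((b−a)/2)²·w((a+b)/2)·M`. -/
theorem weighted_ostrowski_midpoint_Linfty (a b : ℝ) (hab : a < b)
    (f f' w : ℝ → ℝ) (M α β : ℝ)
    (hα : 0 ≤ α) (hβ : 0 ≤ β) (hαβ : 0 < α + β)
    (hw_int : IntervalIntegrable w volume a b)
    (hw_nonneg : ∀ t ∈ Set.Icc a b, 0 ≤ w t)
    (hf'int : IntervalIntegrable f' volume a b)
    (hftc : ∀ y ∈ Set.Icc a b, f y = f a + ∫ t in a..y, f' t)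
    (hM : ∀ᵐ t ∂(volume.restrict (Set.Icc a b)), |f' t| ≤ M)
    (hmax : 0 < ∫ t in a..((a + b) / 2), w t) (hmxb : 0 < ∫ t in ((a + b) / 2)..b, w t)
    (hw_le : ∀ᵐ u ∂(volume.restrict (Set.Icc a b)), w u ≤ w ((a + b) / 2)) :
    |f ((a + b) / 2) - (1 / (α + β)) *
        (α * ((∫ t in a..((a + b) / 2), f t * w t) / (∫ t in a..((a + b) / 2), w t)) +
          β * ((∫ t in ((a + b) / 2)..b, f t * w t) / (∫ t in ((a + b) / 2)..b, w t)))| ≤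
      (1 / (2 * (α + β))) *
        (α / (∫ t in a..((a + b) / 2), w t) + β / (∫ t in ((a + b) / 2)..b, w t)) *
        ((b - a) / 2) ^ 2 * w ((a + b) / 2) * M := by
  set x := (a + b) / 2 with hx
  have hax : a ≤ x := by linarith
  have hxb : x ≤ b := by linarith
  have hleft : Set.Icc a x ⊆ Set.Icc a b := Set.Icc_subset_Icc_right hxb
  have hright : Set.Icc x b ⊆ Set.Icc a b := Set.Icc_subset_Icc_left hax
  have hlip : ∀ t ∈ Set.Icc a b, |f x - f t| ≤ M * |x - t| := fun t ht ↦
    abs_sub_le_mul_abs_sub_of_ae_density_le hf'int hftc hM ⟨hax, hxb⟩ ht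
  have hcont : ContinuousOn f (Set.Icc a b) := by
    have hprim := continuousOn_primitive_interval' hf'int Set.left_mem_uIcc
    rw [Set.uIcc_of_le hab.le] at hprim
    exact (continuousOn_const.add hprim).congr hftc
  have hwi : ∀ {c d : ℝ}, c ≤ d → Set.Icc c d ⊆ Set.Icc a b →
      IntervalIntegrable w volume c d := fun hcd h ↦
    hw_int.mono_set (by rwa [Set.uIcc_of_le hcd, Set.uIcc_of_le hab.le])
  have hL := abs_sub_weighted_mean_le_s12 hax (hcont.mono hleft) (fun t ht ↦ hlip t (hleft ht))
    (hwi hax hleft) (fun t ht ↦ hw_nonneg t (hleft ht))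
    (ae_restrict_of_ae_restrict_of_subset hleft hw_le) hmax
  have hR := abs_sub_weighted_mean_le_s12 hxb (hcont.mono hright) (fun t ht ↦ hlip t (hright ht))
    (hwi hxb hright) (fun t ht ↦ hw_nonneg t (hright ht))
    (ae_restrict_of_ae_restrict_of_subset hright hw_le) hmxb
  rw [integral_abs_right_endpoint_sub hax, show x - a = (b - a) / 2 by rw [hx]; ring] at hL
  rw [integral_abs_left_endpoint_sub hxb, show b - x = (b - a) / 2 by rw [hx]; ring] at hR
  set mL := ∫ t in a..x, w t
  set mR := ∫ t in x..b, w t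
  set A := (∫ t in a..x, f t * w t) / mL
  set B := (∫ t in x..b, f t * w t) / mR
  have hconvex : f x - 1 / (α + β) * (α * A + β * B) =
      (α * (f x - A) + β * (f x - B)) / (α + β) := by
    field_simp
    ring
  rw [hconvex, abs_div, abs_of_pos hαβ, div_le_iff₀ hαβ]
  calc |α * (f x - A) + β * (f x - B)| ≤ α * |f x - A| + β * |f x - B| := by
        refine (abs_add_le _ _).trans_eq ?_
        rw [abs_mul, abs_mul, abs_of_nonneg hα, abs_of_nonneg hβ]
    _ ≤ α * (M * w x * (((b - a) / 2) ^ 2 / 2) / mL) +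
        β * (M * w x * (((b - a) / 2) ^ 2 / 2) / mR) := by gcongr
    _ = _ := by
        field_simp
end
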